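/- arXiv:2604.28144 — 11 statements merged into one kernel-verified Lean document; each statement's English description precedes it below -/
import Mathlib

section
/- For every stationary policy π* : S → Δ(A) (including deterministic ones) and every ε ∈ (0, 1], there exists a parameter θ : S × A → ℝ with |θ(s,a)| ≤ log(2|A|/ε) for all (s,a) ∈ S × A such that the associated softmax policy satisfies max_{s ∈ S} Σ_{a ∈ A} |π_θ(a|s) − π*(a|s)| ≤ ε. In particular, the tabular softmax policy class is dense in the set of stationary policies with respect to the ℓ¹-distance, uniformly over states. -/
/-- Mixing a probability vector with the uniform one, with weight `ε / 2` on the latter, moves it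
by at most `ε` in `ℓ¹`-distance. -/
theorem sum_abs_mix_uniform_sub_le {A : Type*} [Fintype A] [Nonempty A] (p : A → ℝ)
    (hp : ∀ a, 0 ≤ p a) (hsum : ∑ a, p a = 1) {ε : ℝ} (hε : 0 ≤ ε) :
    ∑ a, |((1 - ε / 2) * p a + ε / (2 * (Fintype.card A : ℝ))) - p a| ≤ ε := by
  have hn : (0 : ℝ) < Fintype.card A := by exact_mod_cast Fintype.card_pos
  calc ∑ a, |((1 - ε / 2) * p a + ε / (2 * (Fintype.card A : ℝ))) - p a|
      ≤ ∑ a, (ε / 2 * p a + ε / (2 * (Fintype.card A : ℝ))) := by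
        refine Finset.sum_le_sum fun a _ => ?_
        have h1 : 0 ≤ ε / 2 * p a := mul_nonneg (by linarith) (hp a)
        have h2 : 0 ≤ ε / (2 * (Fintype.card A : ℝ)) := by positivity
        rw [abs_le]
        constructor <;> linarith
    _ = ε := by
        rw [Finset.sum_add_distrib, ← Finset.mul_sum, hsum, Finset.sum_const, Finset.card_univ,
          nsmul_eq_mul]
        field_simp
        ring

/-- Softmax approximation of stationary policies: for every stationary policy
`pistar : S → Δ(A)` and every `ε ∈ (0,1]`, there is a tabular parameter
`θ : S × A → ℝ` with `|θ (s,a)| ≤ log (2|A|/ε)` whose softmax policy is `ε`-close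
to `pistar` in `ℓ¹`-distance, uniformly over states. -/
theorem stmt_0 {S A : Type*} [Fintype S] [Fintype A] [Nonempty S] [Nonempty A]
    (pistar : S → A → ℝ)
    (hnonneg : ∀ s a, 0 ≤ pistar s a)
    (hsum : ∀ s, ∑ a, pistar s a = 1)
    (ε : ℝ) (hε0 : 0 < ε) (hε1 : ε ≤ 1) :
    ∃ θ : S × A → ℝ,
      (∀ s a, |θ (s, a)| ≤ Real.log (2 * (Fintype.card A : ℝ) / ε)) ∧
      ∀ s : S, ∑ a, |Real.exp (θ (s, a)) / (∑ a', Real.exp (θ (s, a'))) - pistar s a| ≤ ε := by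
  have hn : (0 : ℝ) < Fintype.card A := by exact_mod_cast Fintype.card_pos
  set q : S → A → ℝ := fun s a =>
    (1 - ε / 2) * pistar s a + ε / (2 * (Fintype.card A : ℝ)) with hq
  have hδ : 0 < ε / (2 * (Fintype.card A : ℝ)) := by positivity
  have hq_lower : ∀ s a, ε / (2 * (Fintype.card A : ℝ)) ≤ q s a := fun s a =>
    le_add_of_nonneg_left (mul_nonneg (by linarith) (hnonneg s a))
  have hq_pos : ∀ s a, 0 < q s a := fun s a => hδ.trans_le (hq_lower s a)
  have hq_sum : ∀ s, ∑ a, q s a = 1 := fun s => by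
    simp only [hq]
    rw [Finset.sum_add_distrib, ← Finset.mul_sum, hsum, Finset.sum_const, Finset.card_univ,
      nsmul_eq_mul]
    field_simp
    ring
  have hq_le : ∀ s a, q s a ≤ 1 := fun s a => by
    rw [← hq_sum s]
    exact Finset.single_le_sum (fun b _ => (hq_pos s b).le) (Finset.mem_univ a)
  refine ⟨fun x => Real.log (q x.1 x.2), fun s a => ?_, fun s => ?_⟩
  · rw [abs_of_nonpos (Real.log_nonpos (hq_pos s a).le (hq_le s a)), ← Real.log_inv]
    refine Real.log_le_log (inv_pos.2 (hq_pos s a)) ?_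
    rw [← inv_div]
    exact inv_anti₀ hδ (hq_lower s a)
  · simp only [Real.exp_log (hq_pos _ _), hq_sum, div_one]
    exact sum_abs_mix_uniform_sub_le (pistar s) (hnonneg s) (hsum s) hε0.le
end

section
/- Let f : ℝ^d → ℝ be differentiable with L-Lipschitz gradient, and suppose there are constants G_f, F_UB ≥ 0 with ‖∇f(θ)‖ ≤ G_f and |f(θ)| ≤ F_UB for all θ ∈ ℝ^d. Then the quadratic penalty g(θ) := [f(θ)]₊² is L_g-smooth with L_g := 2(F_UB · L + G_f²); that is, ‖∇g(θ) − ∇g(θ')‖ ≤ 2(F_UB L + G_f²) ‖θ − θ'‖ for all θ, θ' ∈ ℝ^d. -/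
/-- The mean value inequality phrased with the gradient. -/
theorem abs_sub_le_of_norm_gradient_le {E : Type*} [NormedAddCommGroup E]
    [InnerProductSpace ℝ E] [CompleteSpace E] {f : E → ℝ} {C : ℝ}
    (hf : Differentiable ℝ f) (hC : ∀ x, ‖gradient f x‖ ≤ C) (x y : E) :
    |f x - f y| ≤ C * ‖x - y‖ := by
  refine convex_univ.norm_image_sub_le_of_norm_fderiv_le (𝕜 := ℝ) (fun z _ => hf z)
    (fun z _ => ?_) (Set.mem_univ y) (Set.mem_univ x)
  rw [← toDual_gradient, LinearIsometryEquiv.norm_map]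
  exact hC z


/-- Smoothness of the quadratic penalty: if `f` is differentiable with `L`-Lipschitz
gradient, `‖∇f‖ ≤ G_f` and `|f| ≤ F_UB` everywhere, then the gradient
`θ ↦ 2 [f θ]₊ • ∇f θ` of the quadratic penalty `[f]₊²` is `2(F_UB L + G_f²)`-Lipschitz. -/
theorem stmt_4 {d : ℕ} (f : EuclideanSpace ℝ (Fin d) → ℝ) (L Gf FUB : ℝ)
    (hGf : 0 ≤ Gf) (hFUB : 0 ≤ FUB)
    (hf : Differentiable ℝ f)
    (hL : ∀ θ θ', ‖gradient f θ - gradient f θ'‖ ≤ L * ‖θ - θ'‖)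
    (hgrad : ∀ θ, ‖gradient f θ‖ ≤ Gf)
    (hbound : ∀ θ, |f θ| ≤ FUB) :
    ∀ θ θ', ‖(2 * max (f θ) 0) • gradient f θ - (2 * max (f θ') 0) • gradient f θ'‖
      ≤ 2 * (FUB * L + Gf ^ 2) * ‖θ - θ'‖ := by
  intro θ θ'
  have hmax : ‖max (f θ) 0‖ ≤ FUB := by
    rw [Real.norm_of_nonneg (le_max_right _ _)]
    exact max_le ((le_abs_self _).trans (hbound θ)) hFUB
  have hdiff : ‖max (f θ) 0 - max (f θ') 0‖ ≤ Gf * ‖θ - θ'‖ :=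
    (abs_max_sub_max_le_abs (f θ) (f θ') 0).trans
      (abs_sub_le_of_norm_gradient_le hf hgrad θ θ')
  have hsplit : (2 * max (f θ) 0) • gradient f θ - (2 * max (f θ') 0) • gradient f θ' =
      (2 : ℝ) • (max (f θ) 0 • (gradient f θ - gradient f θ') +
        (max (f θ) 0 - max (f θ') 0) • gradient f θ') := by
    module
  calc ‖(2 * max (f θ) 0) • gradient f θ - (2 * max (f θ') 0) • gradient f θ'‖
      ≤ 2 * (‖max (f θ) 0‖ * ‖gradient f θ - gradient f θ'‖ +
          ‖max (f θ) 0 - max (f θ') 0‖ * ‖gradient f θ'‖) := by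
        rw [hsplit, norm_smul, Real.norm_two, ← norm_smul, ← norm_smul]
        gcongr
        exact norm_add_le _ _
    _ ≤ 2 * (FUB * (L * ‖θ - θ'‖) + Gf * ‖θ - θ'‖ * Gf) := by
        gcongr
        · exact hL θ θ'
        · exact hgrad θ'
    _ = 2 * (FUB * L + Gf ^ 2) * ‖θ - θ'‖ := by ring
end

section
/- Assume strong duality holds for the constrained problem with multiplier ν* ≥ 0, let β > 2ν*, let ε ≥ 0, and let θ ∈ Θ satisfy the exact-penalty gap bound F₁(θ) − F* + (β/2) [F₂(θ)]₊ ≤ ε. Then the constraint violation satisfies 0 ≤ [F₂(θ)]₊ ≤ ε / (β/2 − ν*). -/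
/-- Constraint-violation translation for the exact penalty: under strong duality with
multiplier `νs ≥ 0`, if `β > 2νs`, `ε ≥ 0` and `F₁ θ - F* + (β/2)[F₂ θ]₊ ≤ ε`, then
`0 ≤ [F₂ θ]₊ ≤ ε / (β/2 - νs)`. -/
theorem stmt_8 {Θ : Type*} [Nonempty Θ] (F₁ F₂ : Θ → ℝ) (θs : Θ) (νs : ℝ)
    (hν : 0 ≤ νs)
    (hfeas : F₂ θs ≤ 0)
    (hopt : ∀ θ, F₂ θ ≤ 0 → F₁ θs ≤ F₁ θ)
    (hsd : IsGLB (Set.range fun θ => F₁ θ + νs * F₂ θ) (F₁ θs))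
    (β ε : ℝ) (hβ : 2 * νs < β) (hε : 0 ≤ ε)
    (θ : Θ) (hgap : F₁ θ - F₁ θs + β / 2 * max (F₂ θ) 0 ≤ ε) :
    0 ≤ max (F₂ θ) 0 ∧ max (F₂ θ) 0 ≤ ε / (β / 2 - νs) := by
  refine ⟨le_max_right _ _, ?_⟩
  have hdual : F₁ θs ≤ F₁ θ + νs * F₂ θ := hsd.1 ⟨θ, rfl⟩
  have hmul : νs * F₂ θ ≤ νs * max (F₂ θ) 0 :=
    mul_le_mul_of_nonneg_left (le_max_left _ _) hν
  rw [le_div_iff₀ (by linarith)]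
  linarith
end

section
/- Assume strong duality holds for the constrained problem with multiplier ν* ≥ 0, let β > 0, let ε ≥ 0, and let θ ∈ Θ satisfy the quadratic-penalty gap bound F₁(θ) − F* + (β/2) [F₂(θ)]₊² ≤ ε. Then the constraint violation satisfies [F₂(θ)]₊ ≤ (ν* + √(ν*² + 2βε)) / β. -/
/-- Constraint-violation translation for the quadratic penalty: under strong duality
with multiplier `νs ≥ 0`, if `β > 0`, `ε ≥ 0` and `F₁ θ - F* + (β/2)[F₂ θ]₊² ≤ ε`,
then `[F₂ θ]₊ ≤ (νs + √(νs² + 2βε)) / β`. -/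
theorem stmt_9 {Θ : Type*} [Nonempty Θ] (F₁ F₂ : Θ → ℝ) (θs : Θ) (νs : ℝ)
    (hν : 0 ≤ νs)
    (hfeas : F₂ θs ≤ 0)
    (hopt : ∀ θ, F₂ θ ≤ 0 → F₁ θs ≤ F₁ θ)
    (hsd : IsGLB (Set.range fun θ => F₁ θ + νs * F₂ θ) (F₁ θs))
    (β ε : ℝ) (hβ : 0 < β) (hε : 0 ≤ ε)
    (θ : Θ) (hgap : F₁ θ - F₁ θs + β / 2 * (max (F₂ θ) 0) ^ 2 ≤ ε) :
    max (F₂ θ) 0 ≤ (νs + Real.sqrt (νs ^ 2 + 2 * β * ε)) / β := by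
  have hlag : F₁ θs ≤ F₁ θ + νs * F₂ θ := hsd.1 ⟨θ, rfl⟩
  have hmul : νs * F₂ θ ≤ νs * max (F₂ θ) 0 :=
    mul_le_mul_of_nonneg_left (le_max_left _ _) hν
  generalize max (F₂ θ) 0 = t at *
  have hquad : β / 2 * t ^ 2 ≤ ε + νs * t := by linarith
  have hsqrt : β * t - νs ≤ Real.sqrt (νs ^ 2 + 2 * β * ε) := by
    apply Real.le_sqrt_of_sq_le
    linarith [mul_le_mul_of_nonneg_left hquad (by positivity : 0 ≤ 2 * β)]
  rw [le_div_iff₀ hβ]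
  linarith
end

section
/- Let c : Θ → ℝ^n be a μ_c-expansive parametrization whose convex image U = c(Θ) has diameter at most D_U > 0, let H₁, H₂ : U → ℝ be convex, and set F₁ := H₁ ∘ c, F₂ := H₂ ∘ c. Let θ* ∈ Θ satisfy F₂(θ*) ≤ 0 and set F* := F₁(θ*). Let L : ℝ → ℝ be convex, non-decreasing, non-negative with L(0) = 0, and let ρ̂ > 0, β > 0, ε_in ≥ 0. Suppose x ∈ Θ and x⁺ ∈ Θ satisfy, for all θ ∈ Θ, F₁(x⁺) + (ρ̂/2)‖x⁺ − x‖² + β L(F₂(x⁺)) ≤ F₁(θ) + (ρ̂/2)‖θ − x‖² + β L(F₂(θ)) + ε_in. Then for every α ∈ [0,1], F₁(x⁺) − F* + β L(F₂(x⁺)) ≤ (1−α)(F₁(x) − F* + β L(F₂(x))) + α² ρ̂ D_U² / (2 μ_c²) + ε_in. -/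
/-- One-step contraction inequality for the inexact proximal-point penalty method
under hidden convexity: if `x⁺` is an `ε_in`-approximate minimizer of
`θ ↦ F₁ θ + (ρ̂/2)‖θ - x‖² + β L (F₂ θ)` over `Θ`, where `F₁ = H₁ ∘ c`,
`F₂ = H₂ ∘ c` are hidden convex via a `μc`-expansive parametrization `c` whose convex
image has diameter at most `D_U`, `θ*` is feasible, and `L` is a convex, non-decreasing,
non-negative penalty with `L 0 = 0`, then for every `α ∈ [0,1]` the penalty gap
contracts. -/
theorem stmt_11 {d n : ℕ} (Θ : Set (EuclideanSpace ℝ (Fin d)))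
    (c : EuclideanSpace ℝ (Fin d) → EuclideanSpace ℝ (Fin n))
    (μc DU : ℝ) (hμc : 0 < μc) (hDU : 0 < DU)
    (hinj : Set.InjOn c Θ)
    (hUconv : Convex ℝ (c '' Θ))
    (hexp : ∀ θ ∈ Θ, ∀ θ' ∈ Θ, μc * ‖θ - θ'‖ ≤ ‖c θ - c θ'‖)
    (hdiam : ∀ u ∈ c '' Θ, ∀ v ∈ c '' Θ, ‖u - v‖ ≤ DU)
    (H₁ H₂ : EuclideanSpace ℝ (Fin n) → ℝ)
    (hH₁ : ∀ u ∈ c '' Θ, ∀ v ∈ c '' Θ, ∀ t ∈ Set.Icc (0:ℝ) 1,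
      H₁ (t • u + (1 - t) • v) ≤ t * H₁ u + (1 - t) * H₁ v)
    (hH₂ : ∀ u ∈ c '' Θ, ∀ v ∈ c '' Θ, ∀ t ∈ Set.Icc (0:ℝ) 1,
      H₂ (t • u + (1 - t) • v) ≤ t * H₂ u + (1 - t) * H₂ v)
    (θs : EuclideanSpace ℝ (Fin d)) (hθs : θs ∈ Θ) (hfeas : H₂ (c θs) ≤ 0)
    (L : ℝ → ℝ) (hLconv : ConvexOn ℝ Set.univ L) (hLmono : Monotone L)
    (hLnonneg : ∀ t, 0 ≤ L t) (hL0 : L 0 = 0)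
    (ρ β εin : ℝ) (hρ : 0 < ρ) (hβ : 0 < β) (hεin : 0 ≤ εin)
    (x xp : EuclideanSpace ℝ (Fin d)) (hx : x ∈ Θ) (hxp : xp ∈ Θ)
    (hmin : ∀ θ ∈ Θ,
      H₁ (c xp) + ρ / 2 * ‖xp - x‖ ^ 2 + β * L (H₂ (c xp))
        ≤ H₁ (c θ) + ρ / 2 * ‖θ - x‖ ^ 2 + β * L (H₂ (c θ)) + εin) :
    ∀ α ∈ Set.Icc (0:ℝ) 1,
      H₁ (c xp) - H₁ (c θs) + β * L (H₂ (c xp))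
        ≤ (1 - α) * (H₁ (c x) - H₁ (c θs) + β * L (H₂ (c x)))
          + α ^ 2 * ρ * DU ^ 2 / (2 * μc ^ 2) + εin := by
  rintro α ⟨hα0, hα1⟩
  have hs : c θs ∈ c '' Θ := ⟨θs, hθs, rfl⟩
  have hcx : c x ∈ c '' Θ := ⟨x, hx, rfl⟩
  have h1α : 0 ≤ 1 - α := sub_nonneg.2 hα1
  obtain ⟨θ, hθ, hcθ⟩ := hUconv hs hcx hα0 h1α (by ring)
  have hdist : ‖θ - x‖ ≤ α * DU / μc := by
    rw [le_div_iff₀ hμc, mul_comm]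
    calc μc * ‖θ - x‖ ≤ ‖c θ - c x‖ := hexp θ hθ x hx
      _ = ‖α • (c θs - c x)‖ := by rw [hcθ]; congr 1; module
      _ = α * ‖c θs - c x‖ := by rw [norm_smul, Real.norm_of_nonneg hα0]
      _ ≤ α * DU := by gcongr; exact hdiam _ hs _ hcx
  have hprox : ρ / 2 * ‖θ - x‖ ^ 2 ≤ α ^ 2 * ρ * DU ^ 2 / (2 * μc ^ 2) :=
    calc ρ / 2 * ‖θ - x‖ ^ 2 ≤ ρ / 2 * (α * DU / μc) ^ 2 := by gcongr
      _ = α ^ 2 * ρ * DU ^ 2 / (2 * μc ^ 2) := by field_simp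
  have hobj : H₁ (c θ) ≤ α * H₁ (c θs) + (1 - α) * H₁ (c x) :=
    hcθ ▸ hH₁ _ hs _ hcx α ⟨hα0, hα1⟩
  have hcon : H₂ (c θ) ≤ α * H₂ (c θs) + (1 - α) * H₂ (c x) :=
    hcθ ▸ hH₂ _ hs _ hcx α ⟨hα0, hα1⟩
  have hLs : L (H₂ (c θs)) ≤ 0 := hL0 ▸ hLmono hfeas
  have hpen : L (H₂ (c θ)) ≤ (1 - α) * L (H₂ (c x)) :=
    calc L (H₂ (c θ)) ≤ L (α * H₂ (c θs) + (1 - α) * H₂ (c x)) := hLmono hcon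
      _ ≤ α * L (H₂ (c θs)) + (1 - α) * L (H₂ (c x)) :=
        hLconv.2 (Set.mem_univ _) (Set.mem_univ _) hα0 h1α (by ring)
      _ ≤ (1 - α) * L (H₂ (c x)) := by
        linarith [mul_nonpos_of_nonneg_of_nonpos hα0 hLs]
  have hβpen := mul_le_mul_of_nonneg_left hpen hβ.le
  have hprox0 : 0 ≤ ρ / 2 * ‖xp - x‖ ^ 2 := by positivity
  linarith [hmin θ hθ]
end

section
/- Let c : Θ → ℝ^n be a μ_c-expansive parametrization whose convex image U = c(Θ) has diameter at most D_U > 0, let H₁, H₂ : U → ℝ be convex, and set F₁ := H₁ ∘ c, F₂ := H₂ ∘ c. Let θ* ∈ Θ be a minimizer of F₁ over {θ ∈ Θ : F₂(θ) ≤ 0} with F* := F₁(θ*) and F₂(θ*) ≤ 0. Let L : ℝ → ℝ be convex, non-decreasing, non-negative with L(0) = 0, let ρ̂ > 0, β > 0, and let (x^k)_{k≥0} ⊆ Θ be a sequence such that for every k, x^{k+1} is an ε_in-approximate minimizer over Θ of φ_k(θ) := F₁(θ) + (ρ̂/2)‖θ − x^k‖² + β L(F₂(θ)), i.e. φ_k(x^{k+1})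 ≤ φ_k(θ) + ε_in for all θ ∈ Θ. Let ε ∈ (0, 3ρ̂D_U²/(2μ_c²)], set α := 2 μ_c² ε / (3 ρ̂ D_U²) ∈ (0,1], assume ε_in ≤ α ε / 3, and set Δ₀ := F₁(x^0) − F* and V₀ := L(F₂(x^0)). If 3(Δ₀ + β V₀) ≥ ε, Δ₀ + β V₀ > 0, and N ≥ (1/α) · log(3(Δ₀ + β V₀)/ε), then the last iterate satisfies F₁(x^N) − F* + (β/2) L(F₂(x^N)) ≤ ε. -/
/-- A sequence with `a (k + 1) ≤ (1 - α) * a k + α * δ` satisfies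
`a N ≤ exp (-(α * N)) * a 0 + δ`. -/
theorem le_exp_mul_add_of_contraction {a : ℕ → ℝ} {α δ : ℝ} (hα₁ : α ≤ 1) (hδ : 0 ≤ δ)
    (ha₀ : 0 ≤ a 0) (hrec : ∀ k, a (k + 1) ≤ (1 - α) * a k + α * δ) (N : ℕ) :
    a N ≤ Real.exp (-(α * N)) * a 0 + δ := by
  have hpow : a N ≤ (1 - α) ^ N * a 0 + δ := by
    induction N with
    | zero => simpa using hδ
    | succ k ih =>
      calc a (k + 1) ≤ (1 - α) * a k + α * δ := hrec k
        _ ≤ (1 - α) * ((1 - α) ^ k * a 0 + δ) + α * δ := by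
          have := mul_le_mul_of_nonneg_left ih (sub_nonneg.2 hα₁)
          linarith
        _ = (1 - α) ^ (k + 1) * a 0 + δ := by ring
  have hexp : (1 - α) ^ N ≤ Real.exp (-(α * N)) :=
    calc (1 - α) ^ N ≤ Real.exp (-α) ^ N :=
          pow_le_pow_left₀ (sub_nonneg.2 hα₁) (Real.one_sub_le_exp_neg α) N
      _ = Real.exp (-(α * N)) := by rw [← Real.exp_nat_mul]; ring_nf
  have := mul_le_mul_of_nonneg_right hexp ha₀
  linarith

/-- If `c` is `μ`-expansive with convex image `c '' Θ` of diameter at most `D`, the point of `Θ`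
parametrizing `t • c y + (1 - t) • c z` lies within `t * D / μ` of `z`. -/
theorem exists_segment_preimage_sq_norm_sub_le {E F : Type*} [SeminormedAddCommGroup E]
    [SeminormedAddCommGroup F] [NormedSpace ℝ F] {Θ : Set E} {c : E → F} {μ D : ℝ} (hμ : 0 < μ)
    (hconv : Convex ℝ (c '' Θ))
    (hexp : ∀ θ ∈ Θ, ∀ θ' ∈ Θ, μ * ‖θ - θ'‖ ≤ ‖c θ - c θ'‖)
    (hdiam : ∀ u ∈ c '' Θ, ∀ v ∈ c '' Θ, ‖u - v‖ ≤ D)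
    {y z : E} (hy : y ∈ Θ) (hz : z ∈ Θ) {t : ℝ} (ht : t ∈ Set.Icc (0 : ℝ) 1) :
    ∃ θ ∈ Θ, c θ = t • c y + (1 - t) • c z ∧ ‖θ - z‖ ^ 2 ≤ (t * D / μ) ^ 2 := by
  obtain ⟨θ, hθ, hcθ⟩ := hconv (Set.mem_image_of_mem c hy) (Set.mem_image_of_mem c hz)
    ht.1 (sub_nonneg.2 ht.2) (add_sub_cancel t 1)
  refine ⟨θ, hθ, hcθ, pow_le_pow_left₀ (norm_nonneg _) ?_ 2⟩
  have hdiff : c θ - c z = t • (c y - c z) := by rw [hcθ]; module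
  rw [le_div_iff₀' hμ]
  calc μ * ‖θ - z‖ ≤ ‖c θ - c z‖ := hexp θ hθ z hz
    _ = t * ‖c y - c z‖ := by rw [hdiff, norm_smul, Real.norm_of_nonneg ht.1]
    _ ≤ t * D := mul_le_mul_of_nonneg_left
      (hdiam _ (Set.mem_image_of_mem c hy) _ (Set.mem_image_of_mem c hz)) ht.1


/-- Last-iterate convergence of the inexact proximal-point penalty method under
hidden convexity: with `α := 2 μc² ε / (3 ρ̂ D_U²)`, inner accuracy
`ε_in ≤ α ε / 3`, and `N ≥ (1/α) log (3(Δ₀ + β V₀)/ε)` iterations, the last iterate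
satisfies `F₁ (x N) - F* + (β/2) L (F₂ (x N)) ≤ ε`. -/
theorem stmt_12 {d n : ℕ} (Θ : Set (EuclideanSpace ℝ (Fin d)))
    (c : EuclideanSpace ℝ (Fin d) → EuclideanSpace ℝ (Fin n))
    (μc DU : ℝ) (hμc : 0 < μc) (hDU : 0 < DU)
    (hinj : Set.InjOn c Θ)
    (hUconv : Convex ℝ (c '' Θ))
    (hexp : ∀ θ ∈ Θ, ∀ θ' ∈ Θ, μc * ‖θ - θ'‖ ≤ ‖c θ - c θ'‖)
    (hdiam : ∀ u ∈ c '' Θ, ∀ v ∈ c '' Θ, ‖u - v‖ ≤ DU)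
    (H₁ H₂ : EuclideanSpace ℝ (Fin n) → ℝ)
    (hH₁ : ∀ u ∈ c '' Θ, ∀ v ∈ c '' Θ, ∀ t ∈ Set.Icc (0:ℝ) 1,
      H₁ (t • u + (1 - t) • v) ≤ t * H₁ u + (1 - t) * H₁ v)
    (hH₂ : ∀ u ∈ c '' Θ, ∀ v ∈ c '' Θ, ∀ t ∈ Set.Icc (0:ℝ) 1,
      H₂ (t • u + (1 - t) • v) ≤ t * H₂ u + (1 - t) * H₂ v)
    (θs : EuclideanSpace ℝ (Fin d)) (hθs : θs ∈ Θ) (hfeas : H₂ (c θs) ≤ 0)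
    (hopt : ∀ θ ∈ Θ, H₂ (c θ) ≤ 0 → H₁ (c θs) ≤ H₁ (c θ))
    (L : ℝ → ℝ) (hLconv : ConvexOn ℝ Set.univ L) (hLmono : Monotone L)
    (hLnonneg : ∀ t, 0 ≤ L t) (hL0 : L 0 = 0)
    (ρ β εin : ℝ) (hρ : 0 < ρ) (hβ : 0 < β) (hεin0 : 0 ≤ εin)
    (x : ℕ → EuclideanSpace ℝ (Fin d)) (hxΘ : ∀ k, x k ∈ Θ)
    (happrox : ∀ k, ∀ θ ∈ Θ,
      H₁ (c (x (k + 1))) + ρ / 2 * ‖x (k + 1) - x k‖ ^ 2 + β * L (H₂ (c (x (k + 1))))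
        ≤ H₁ (c θ) + ρ / 2 * ‖θ - x k‖ ^ 2 + β * L (H₂ (c θ)) + εin)
    (ε α Δ₀ V₀ : ℝ)
    (hε0 : 0 < ε) (hεub : ε ≤ 3 * ρ * DU ^ 2 / (2 * μc ^ 2))
    (hα : α = 2 * μc ^ 2 * ε / (3 * ρ * DU ^ 2))
    (hεin : εin ≤ α * ε / 3)
    (hΔ₀ : Δ₀ = H₁ (c (x 0)) - H₁ (c θs))
    (hV₀ : V₀ = L (H₂ (c (x 0))))
    (hlb : ε ≤ 3 * (Δ₀ + β * V₀)) (hpos : 0 < Δ₀ + β * V₀)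
    (N : ℕ) (hN : (1 / α) * Real.log (3 * (Δ₀ + β * V₀) / ε) ≤ (N : ℝ)) :
    H₁ (c (x N)) - H₁ (c θs) + β / 2 * L (H₂ (c (x N))) ≤ ε := by
  have hα0 : 0 < α := by rw [hα]; positivity
  have hα1 : α ≤ 1 := by
    rw [le_div_iff₀ (by positivity)] at hεub
    rw [hα, div_le_one (by positivity)]
    linarith
  have hstep : ρ / 2 * (α * DU / μc) ^ 2 = α * (ε / 3) := by
    have h : α * (3 * ρ * DU ^ 2) = 2 * μc ^ 2 * ε := by
      rw [hα]; field_simp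
    field_simp
    linear_combination h
  have hα_mem : α ∈ Set.Icc (0 : ℝ) 1 := ⟨hα0.le, hα1⟩
  have hrec : ∀ k, H₁ (c (x (k + 1))) - H₁ (c θs) + β * L (H₂ (c (x (k + 1))))
      ≤ (1 - α) * (H₁ (c (x k)) - H₁ (c θs) + β * L (H₂ (c (x k)))) + α * (2 * ε / 3) := by
    intro k
    obtain ⟨θ, hθ, hcθ, hnorm⟩ :=
      exists_segment_preimage_sq_norm_sub_le hμc hUconv hexp hdiam hθs (hxΘ k) hα_mem
    have hs := Set.mem_image_of_mem c hθs
    have hk := Set.mem_image_of_mem c (hxΘ k)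
    have hF₁ := hH₁ _ hs _ hk α hα_mem
    have hF₂ := hH₂ _ hs _ hk α hα_mem
    rw [← hcθ] at hF₁ hF₂
    have hpen : L (H₂ (c θ)) ≤ (1 - α) * L (H₂ (c (x k))) := by
      have hcomb := hLconv.2 (Set.mem_univ 0) (Set.mem_univ (H₂ (c (x k)))) hα0.le
        (sub_nonneg.2 hα1) (add_sub_cancel α 1)
      simp only [smul_eq_mul, mul_zero, zero_add, hL0] at hcomb
      refine (hLmono (hF₂.trans ?_)).trans hcomb
      linarith [mul_nonpos_of_nonneg_of_nonpos hα0.le hfeas]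
    have hprox : ρ / 2 * ‖θ - x k‖ ^ 2 ≤ α * (ε / 3) :=
      (mul_le_mul_of_nonneg_left hnorm (by positivity)).trans_eq hstep
    have hnonneg : 0 ≤ ρ / 2 * ‖x (k + 1) - x k‖ ^ 2 := by positivity
    linarith [happrox k θ hθ, mul_le_mul_of_nonneg_left hpen hβ.le]
  subst hΔ₀ hV₀
  have hmain := le_exp_mul_add_of_contraction
    (a := fun k => H₁ (c (x k)) - H₁ (c θs) + β * L (H₂ (c (x k)))) hα1
    (by positivity : 0 ≤ 2 * ε / 3) hpos.le hrec N
  have hdecay : Real.exp (-(α * N)) * (H₁ (c (x 0)) - H₁ (c θs) + β * L (H₂ (c (x 0))))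
      ≤ ε / 3 := by
    rw [one_div, inv_mul_le_iff₀ hα0, Real.log_le_iff_le_exp (by positivity),
      div_le_iff₀ hε0] at hN
    rw [Real.exp_neg, inv_mul_le_iff₀ (Real.exp_pos _)]
    linarith
  have hL := mul_nonneg hβ.le (hLnonneg (H₂ (c (x N))))
  linarith
end

section
/- Assume strong duality holds for the constrained problem with multiplier ν* ≥ 0, let β ≥ 2ν* + 2, let ε ≥ 0, and suppose x ∈ Θ satisfies the exact-penalty gap bound F₁(x) − F* + (β/2)[F₂(x)]₊ ≤ ε/β. Then both |F₁(x) − F*| ≤ ε and [F₂(x)]₊ ≤ ε. -/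
/-- Exact-penalty translation under strong duality: if `β ≥ 2ν* + 2` and the
exact-penalty gap of `x` is at most `ε/β`, then `|F₁ x - F*| ≤ ε` and
`[F₂ x]₊ ≤ ε`. -/
theorem stmt_13 {Θ : Type*} [Nonempty Θ] (F₁ F₂ : Θ → ℝ) (θs : Θ) (νs : ℝ)
    (hν : 0 ≤ νs)
    (hfeas : F₂ θs ≤ 0)
    (hopt : ∀ θ, F₂ θ ≤ 0 → F₁ θs ≤ F₁ θ)
    (hsd : IsGLB (Set.range fun θ => F₁ θ + νs * F₂ θ) (F₁ θs))
    (β ε : ℝ) (hβ : 2 * νs + 2 ≤ β) (hε : 0 ≤ ε)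
    (x : Θ) (hgap : F₁ x - F₁ θs + β / 2 * max (F₂ x) 0 ≤ ε / β) :
    |F₁ x - F₁ θs| ≤ ε ∧ max (F₂ x) 0 ≤ ε := by
  have hβ0 : 0 < β := by linarith
  have hlow : F₁ θs ≤ F₁ x + νs * F₂ x := hsd.1 ⟨x, rfl⟩
  have hp0 : 0 ≤ max (F₂ x) 0 := le_max_right _ _
  have hνp : νs * F₂ x ≤ νs * max (F₂ x) 0 :=
    mul_le_mul_of_nonneg_left (le_max_left _ _) hν
  have hq0 : 0 ≤ ε / β := div_nonneg hε hβ0.le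
  have hqβ : ε / β * β = ε := div_mul_cancel₀ ε hβ0.ne'
  generalize max (F₂ x) 0 = p at *
  generalize ε / β = q at *
  have hpq : p ≤ q := by nlinarith [mul_nonneg hp0 (sub_nonneg.2 hβ)]
  have hqε : q ≤ ε := by nlinarith
  have hνpε : νs * p ≤ ε := by nlinarith [mul_le_mul_of_nonneg_left hpq hν]
  have hβp : 0 ≤ β / 2 * p := by positivity
  exact ⟨abs_le.2 ⟨by linarith, by linarith⟩, hpq.trans hqε⟩
end

section
/- Assume strong duality holds for the constrained problem with multiplier ν* ≥ 0, let ε > 0, set β := (ν* + 1)(ν* + √(ν*² + 2)) / ε, and suppose x ∈ Θ satisfies the quadratic-penalty gap bound F₁(x) − F* + (β/2)[F₂(x)]₊² ≤ 1/β. Then both |F₁(x) − F*| ≤ ε and [F₂(x)]₊ ≤ ε. -/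
/-- Quadratic-penalty translation under strong duality: with
`β := (ν* + 1)(ν* + √(ν*² + 2)) / ε`, if the quadratic-penalty gap of `x` is at most
`1/β`, then `|F₁ x - F*| ≤ ε` and `[F₂ x]₊ ≤ ε`. -/
theorem stmt_14 {Θ : Type*} [Nonempty Θ] (F₁ F₂ : Θ → ℝ) (θs : Θ) (νs : ℝ)
    (hν : 0 ≤ νs)
    (hfeas : F₂ θs ≤ 0)
    (hopt : ∀ θ, F₂ θ ≤ 0 → F₁ θs ≤ F₁ θ)
    (hsd : IsGLB (Set.range fun θ => F₁ θ + νs * F₂ θ) (F₁ θs))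
    (ε β : ℝ) (hε : 0 < ε)
    (hβ : β = (νs + 1) * (νs + Real.sqrt (νs ^ 2 + 2)) / ε)
    (x : Θ) (hgap : F₁ x - F₁ θs + β / 2 * (max (F₂ x) 0) ^ 2 ≤ 1 / β) :
    |F₁ x - F₁ θs| ≤ ε ∧ max (F₂ x) 0 ≤ ε := by
  have hlow : F₁ θs ≤ F₁ x + νs * F₂ x := hsd.1 ⟨x, rfl⟩
  set p := max (F₂ x) 0
  have hp0 : 0 ≤ p := le_max_right _ _
  have hmul : νs * F₂ x ≤ νs * p := mul_le_mul_of_nonneg_left (le_max_left _ _) hν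
  set s := Real.sqrt (νs ^ 2 + 2)
  have hss : s ^ 2 = νs ^ 2 + 2 := Real.sq_sqrt (by positivity)
  have hs1 : 1 ≤ s := Real.one_le_sqrt.2 (by nlinarith)
  have hβ0 : 0 < β := by rw [hβ]; positivity
  have hβε : β * ε = (νs + 1) * (νs + s) := by rw [hβ]; field_simp
  have hquad : (β * p - νs) ^ 2 ≤ s ^ 2 := by
    have h : β / 2 * p ^ 2 - νs * p ≤ 1 / β := by linarith
    rw [le_div_iff₀ hβ0] at h
    nlinarith
  have hβp : β * p ≤ νs + s := by
    have := abs_le_of_sq_le_sq' hquad (by linarith)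
    linarith [this.2]
  have hpε : (νs + 1) * p ≤ ε := by
    refine le_of_mul_le_mul_left ?_ hβ0
    nlinarith [mul_le_mul_of_nonneg_left hβp (by linarith : 0 ≤ νs + 1)]
  have hνp : 0 ≤ νs * p := mul_nonneg hν hp0
  have hinv : 1 / β ≤ ε := by
    rw [div_le_iff₀ hβ0]
    nlinarith
  have hpen : 0 ≤ β / 2 * p ^ 2 := by positivity
  exact ⟨abs_le.2 ⟨by linarith, by linarith⟩, by linarith⟩
end

section
/- Let c : Θ → ℝ^n be a μ_c-expansive parametrization with convex image U = c(Θ), let μ_H > 0, let H₁ : U → ℝ be μ_H-strongly convex and H₂ : U → ℝ convex, and set F₁ := H₁ ∘ c, F₂ := H₂ ∘ c. Let θ* ∈ Θ satisfy F₂(θ*) ≤ 0 and F* := F₁(θ*) = inf{F₁(θ) : θ ∈ Θ, F₂(θ) ≤ 0}. Let L : ℝ → ℝ be convex, non-decreasing, non-negative with L(0) = 0, let ρ̂ > 0, β > 0, and let (x^k)_{k≥0} ⊆ Θ be such that for every k, x^{k+1} satisfies φ_k(x^{k+1}) ≤ φ_k(θ) + ε_in for all θ ∈ Θ, where φ_k(θ)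 := F₁(θ) + (ρ̂/2)‖θ − x^k‖² + β L(F₂(θ)). Set α := μ_c² μ_H / (ρ̂ + μ_c² μ_H) ∈ (0,1), Δ₀ := F₁(x^0) − F*, V₀ := L(F₂(x^0)), and let ε > 0 with ε ≤ 2(Δ₀ + β V₀). If ε_in ≤ α ε / 2 and N ≥ (1/α) · log(2(Δ₀ + β V₀)/ε), then the last iterate satisfies F₁(x^N) − F* + (β/2) L(F₂(x^N)) ≤ ε. -/
/-- A sequence contracting by `1 - α` up to an error `α * b` is bounded by
`exp (-α N) * a 0 + b`. -/
theorem le_exp_mul_add_of_contraction_s15 {a : ℕ → ℝ} {α b : ℝ} (hα1 : α ≤ 1) (ha0 : 0 ≤ a 0)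
    (hb : 0 ≤ b) (hstep : ∀ k, a (k + 1) ≤ (1 - α) * a k + α * b) (N : ℕ) :
    a N ≤ Real.exp (-(α * N)) * a 0 + b := by
  have hpow : ∀ k, a k ≤ (1 - α) ^ k * a 0 + b := by
    intro k
    induction k with
    | zero => simpa using hb
    | succ k ih =>
      have h := mul_le_mul_of_nonneg_left ih (sub_nonneg.2 hα1)
      calc a (k + 1) ≤ (1 - α) * a k + α * b := hstep k
        _ ≤ (1 - α) * ((1 - α) ^ k * a 0 + b) + α * b := by gcongr
        _ = (1 - α) ^ (k + 1) * a 0 + b := by ring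
  have hexp : (1 - α) ^ N ≤ Real.exp (-(α * N)) := by
    calc (1 - α) ^ N ≤ Real.exp (-α) ^ N :=
          pow_le_pow_left₀ (sub_nonneg.2 hα1) (Real.one_sub_le_exp_neg α) N
      _ = Real.exp (-(α * N)) := by rw [← Real.exp_nat_mul]; ring_nf
  calc a N ≤ (1 - α) ^ N * a 0 + b := hpow N
    _ ≤ Real.exp (-(α * N)) * a 0 + b := by gcongr

/-- Hidden strong convexity absorbs the proximal term: for an expansive parametrization `c`,
a function `G` that is `μH`-strongly convex on the image of `c` can be decreased geometrically
towards its value at any `y`, even with a proximal penalty centred at `x`. -/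
theorem exists_proximal_le_of_expansive {E F : Type*} [NormedAddCommGroup E]
    [NormedAddCommGroup F] [NormedSpace ℝ F] {Θ : Set E} {c : E → F} {μc μH ρ α : ℝ}
    (hμc : 0 < μc) (hμH : 0 < μH) (hρ : 0 < ρ) (hUconv : Convex ℝ (c '' Θ))
    (hexp : ∀ θ ∈ Θ, ∀ θ' ∈ Θ, μc * ‖θ - θ'‖ ≤ ‖c θ - c θ'‖) {G : F → ℝ}
    (hG : ∀ u ∈ c '' Θ, ∀ v ∈ c '' Θ, ∀ t ∈ Set.Icc (0:ℝ) 1,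
      G (t • u + (1 - t) • v) ≤ t * G u + (1 - t) * G v - μH / 2 * t * (1 - t) * ‖u - v‖ ^ 2)
    (hα : α = μc ^ 2 * μH / (ρ + μc ^ 2 * μH)) {x y : E} (hx : x ∈ Θ) (hy : y ∈ Θ) :
    ∃ θ ∈ Θ, G (c θ) + ρ / 2 * ‖θ - x‖ ^ 2 ≤ α * G (c y) + (1 - α) * G (c x) := by
  have hm : 0 < μc ^ 2 * μH := by positivity
  have hα0 : 0 ≤ α := by rw [hα]; positivity
  have hα1 : α ≤ 1 := by rw [hα, div_le_one (by positivity)]; linarith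
  have hbalance : ρ * α = μc ^ 2 * μH * (1 - α) := by rw [hα]; field_simp; ring
  have hux := Set.mem_image_of_mem c hx
  have huy := Set.mem_image_of_mem c hy
  obtain ⟨θ, hθ, hcθ⟩ := hUconv huy hux hα0 (sub_nonneg.2 hα1) (by ring)
  refine ⟨θ, hθ, ?_⟩
  have hdist : μc * ‖θ - x‖ ≤ α * ‖c y - c x‖ := by
    have h := hexp θ hθ x hx
    have heq : c θ - c x = α • (c y - c x) := by rw [hcθ]; module
    rwa [heq, norm_smul, Real.norm_of_nonneg hα0] at h
  have hsq : μc ^ 2 * ‖θ - x‖ ^ 2 ≤ α ^ 2 * ‖c y - c x‖ ^ 2 := by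
    simpa [mul_pow] using pow_le_pow_left₀ (by positivity) hdist 2
  have hprox : ρ / 2 * ‖θ - x‖ ^ 2 ≤ μH / 2 * α * (1 - α) * ‖c y - c x‖ ^ 2 := by
    refine le_of_mul_le_mul_left ?_ (pow_pos hμc 2)
    calc μc ^ 2 * (ρ / 2 * ‖θ - x‖ ^ 2) = ρ / 2 * (μc ^ 2 * ‖θ - x‖ ^ 2) := by ring
      _ ≤ ρ / 2 * (α ^ 2 * ‖c y - c x‖ ^ 2) := by gcongr
      _ = ρ * α * (α / 2 * ‖c y - c x‖ ^ 2) := by ring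
      _ = μc ^ 2 * (μH / 2 * α * (1 - α) * ‖c y - c x‖ ^ 2) := by rw [hbalance]; ring
  have h := hG _ huy _ hux α ⟨hα0, hα1⟩
  rw [← hcθ] at h
  linarith

/-- Linear convergence of the inexact proximal-point penalty method under hidden
*strong* convexity: with `α := μc² μH / (ρ̂ + μc² μH)`, inner accuracy
`ε_in ≤ α ε / 2`, and `N ≥ (1/α) log (2(Δ₀ + β V₀)/ε)` iterations, the last iterate
satisfies `F₁ (x N) - F* + (β/2) L (F₂ (x N)) ≤ ε`. -/
theorem stmt_15 {d n : ℕ} (Θ : Set (EuclideanSpace ℝ (Fin d)))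
    (c : EuclideanSpace ℝ (Fin d) → EuclideanSpace ℝ (Fin n))
    (μc μH : ℝ) (hμc : 0 < μc) (hμH : 0 < μH)
    (hinj : Set.InjOn c Θ)
    (hUconv : Convex ℝ (c '' Θ))
    (hexp : ∀ θ ∈ Θ, ∀ θ' ∈ Θ, μc * ‖θ - θ'‖ ≤ ‖c θ - c θ'‖)
    (H₁ H₂ : EuclideanSpace ℝ (Fin n) → ℝ)
    (hH₁ : ∀ u ∈ c '' Θ, ∀ v ∈ c '' Θ, ∀ t ∈ Set.Icc (0:ℝ) 1,
      H₁ (t • u + (1 - t) • v) ≤ t * H₁ u + (1 - t) * H₁ v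
        - μH / 2 * t * (1 - t) * ‖u - v‖ ^ 2)
    (hH₂ : ∀ u ∈ c '' Θ, ∀ v ∈ c '' Θ, ∀ t ∈ Set.Icc (0:ℝ) 1,
      H₂ (t • u + (1 - t) • v) ≤ t * H₂ u + (1 - t) * H₂ v)
    (θs : EuclideanSpace ℝ (Fin d)) (hθs : θs ∈ Θ) (hfeas : H₂ (c θs) ≤ 0)
    (hopt : ∀ θ ∈ Θ, H₂ (c θ) ≤ 0 → H₁ (c θs) ≤ H₁ (c θ))
    (L : ℝ → ℝ) (hLconv : ConvexOn ℝ Set.univ L) (hLmono : Monotone L)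
    (hLnonneg : ∀ t, 0 ≤ L t) (hL0 : L 0 = 0)
    (ρ β εin : ℝ) (hρ : 0 < ρ) (hβ : 0 < β) (hεin0 : 0 ≤ εin)
    (x : ℕ → EuclideanSpace ℝ (Fin d)) (hxΘ : ∀ k, x k ∈ Θ)
    (happrox : ∀ k, ∀ θ ∈ Θ,
      H₁ (c (x (k + 1))) + ρ / 2 * ‖x (k + 1) - x k‖ ^ 2 + β * L (H₂ (c (x (k + 1))))
        ≤ H₁ (c θ) + ρ / 2 * ‖θ - x k‖ ^ 2 + β * L (H₂ (c θ)) + εin)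
    (ε α Δ₀ V₀ : ℝ)
    (hα : α = μc ^ 2 * μH / (ρ + μc ^ 2 * μH))
    (hΔ₀ : Δ₀ = H₁ (c (x 0)) - H₁ (c θs))
    (hV₀ : V₀ = L (H₂ (c (x 0))))
    (hε0 : 0 < ε) (hεub : ε ≤ 2 * (Δ₀ + β * V₀))
    (hεin : εin ≤ α * ε / 2)
    (N : ℕ) (hN : (1 / α) * Real.log (2 * (Δ₀ + β * V₀) / ε) ≤ (N : ℝ)) :
    H₁ (c (x N)) - H₁ (c θs) + β / 2 * L (H₂ (c (x N))) ≤ ε := by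
  have hm : 0 < μc ^ 2 * μH := by positivity
  have hα0 : 0 < α := by rw [hα]; positivity
  have hα1 : α ≤ 1 := by rw [hα, div_le_one (by positivity)]; linarith
  have hLs : L (H₂ (c θs)) = 0 := le_antisymm (hL0 ▸ hLmono hfeas) (hLnonneg _)
  have hG : ∀ u ∈ c '' Θ, ∀ v ∈ c '' Θ, ∀ t ∈ Set.Icc (0:ℝ) 1,
      H₁ (t • u + (1 - t) • v) + β * L (H₂ (t • u + (1 - t) • v))
        ≤ t * (H₁ u + β * L (H₂ u)) + (1 - t) * (H₁ v + β * L (H₂ v))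
          - μH / 2 * t * (1 - t) * ‖u - v‖ ^ 2 := by
    intro u hu v hv t ht
    have hLcomp : L (H₂ (t • u + (1 - t) • v)) ≤ t * L (H₂ u) + (1 - t) * L (H₂ v) :=
      (hLmono (hH₂ u hu v hv t ht)).trans
        (hLconv.2 (Set.mem_univ _) (Set.mem_univ _) ht.1 (sub_nonneg.2 ht.2) (by ring))
    have h := mul_le_mul_of_nonneg_left hLcomp hβ.le
    linarith [hH₁ u hu v hv t ht]
  have hinit : 0 < Δ₀ + β * V₀ := by linarith
  have hgap := le_exp_mul_add_of_contraction_s15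
    (a := fun k ↦ H₁ (c (x k)) - H₁ (c θs) + β * L (H₂ (c (x k)))) (b := ε / 2) hα1
    (by simpa only [hΔ₀, hV₀] using hinit.le) (by positivity) (fun k ↦ by
      obtain ⟨θ, hθ, hle⟩ :=
        exists_proximal_le_of_expansive (G := fun u ↦ H₁ u + β * L (H₂ u))
          hμc hμH hρ hUconv hexp hG hα (hxΘ k) hθs
      have hprox : 0 ≤ ρ / 2 * ‖x (k + 1) - x k‖ ^ 2 := by positivity
      simp only [hLs] at hle
      linarith [happrox k θ hθ]) N
  have hdecay : Real.exp (-(α * N)) * (Δ₀ + β * V₀) ≤ ε / 2 := by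
    have hlog : Real.log (2 * (Δ₀ + β * V₀) / ε) ≤ α * N := by
      rwa [one_div, inv_mul_le_iff₀ hα0] at hN
    rw [Real.log_le_iff_le_exp (by positivity), div_le_iff₀ hε0] at hlog
    rw [Real.exp_neg, inv_mul_le_iff₀ (Real.exp_pos _)]
    linarith
  have hV : 0 ≤ β * L (H₂ (c (x N))) := mul_nonneg hβ.le (hLnonneg _)
  simp only [← hΔ₀, ← hV₀] at hgap
  linarith
end

section
/- Let A be a finite nonempty type, let ℓ_ψ > 0, and let ψ : ℝ^p × A → ℝ be such that for each a ∈ A the map θ ↦ ψ(θ, a) is differentiable with ‖∇_θ ψ(θ, a)‖ ≤ ℓ_ψ for all θ ∈ ℝ^p. Define the softmax policy π_θ(a) := exp(ψ(θ, a)) / Σ_{a' ∈ A} exp(ψ(θ, a')). Then for every a ∈ A the score function θ ↦ log π_θ(a) is differentiable and satisfies ‖∇_θ log π_θ(a)‖ ≤ 2 ℓ_ψ for all θ ∈ ℝ^p. -/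
theorem norm_gradient_eq_norm_fderiv {F : Type*} [NormedAddCommGroup F] [InnerProductSpace ℝ F]
    [CompleteSpace F] (f : F → ℝ) (x : F) : ‖gradient f x‖ = ‖fderiv ℝ f x‖ := by
  simp [gradient]

theorem hasFDerivAt_log_sum_exp {E A : Type*} [NormedAddCommGroup E] [NormedSpace ℝ E]
    [Fintype A] [Nonempty A] {f : E → A → ℝ} {f' : A → E →L[ℝ] ℝ} {x : E}
    (hf : ∀ a, HasFDerivAt (fun y => f y a) (f' a) x) :
    HasFDerivAt (fun y => Real.log (∑ a, Real.exp (f y a)))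
      ((∑ a, Real.exp (f x a))⁻¹ • ∑ a, Real.exp (f x a) • f' a) x := by
  have hpos : 0 < ∑ a, Real.exp (f x a) :=
    Finset.sum_pos (fun a _ => Real.exp_pos _) Finset.univ_nonempty
  exact (HasFDerivAt.fun_sum fun a _ => (hf a).exp).log hpos.ne'

theorem norm_inv_sum_smul_sum_le {A V : Type*} [NormedAddCommGroup V] [NormedSpace ℝ V]
    [Fintype A] {w : A → ℝ} {v : A → V} {C : ℝ} (hw : ∀ a, 0 ≤ w a) (hpos : 0 < ∑ a, w a)
    (hv : ∀ a, ‖v a‖ ≤ C) : ‖(∑ a, w a)⁻¹ • ∑ a, w a • v a‖ ≤ C := by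
  rw [norm_smul, norm_inv, Real.norm_of_nonneg hpos.le, inv_mul_le_iff₀ hpos, Finset.sum_mul]
  refine norm_sum_le_of_le _ fun a _ => ?_
  rw [norm_smul, Real.norm_of_nonneg (hw a)]
  exact mul_le_mul_of_nonneg_left (hv a) (hw a)


/-- Boundedness of the softmax score function: if each `θ ↦ ψ θ a` is differentiable
with gradient norm at most `ℓψ`, then for every action `a` the log-softmax
`θ ↦ log π_θ(a)` is differentiable with gradient norm at most `2 ℓψ`. -/
theorem stmt_16 {p : ℕ} {A : Type*} [Fintype A] [Nonempty A]
    (ψ : EuclideanSpace ℝ (Fin p) → A → ℝ) (lψ : ℝ) (hlψ : 0 < lψ)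
    (hdiff : ∀ a, Differentiable ℝ (fun θ => ψ θ a))
    (hgrad : ∀ a θ, ‖gradient (fun θ' => ψ θ' a) θ‖ ≤ lψ) :
    ∀ a : A,
      Differentiable ℝ
        (fun θ => Real.log (Real.exp (ψ θ a) / ∑ a', Real.exp (ψ θ a'))) ∧
      ∀ θ, ‖gradient
        (fun θ' => Real.log (Real.exp (ψ θ' a) / ∑ a', Real.exp (ψ θ' a'))) θ‖
          ≤ 2 * lψ := by
  intro a
  have hpos : ∀ θ, 0 < ∑ a', Real.exp (ψ θ a') := fun θ =>
    Finset.sum_pos (fun _ _ => Real.exp_pos _) Finset.univ_nonempty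
  have hlog : (fun θ => Real.log (Real.exp (ψ θ a) / ∑ a', Real.exp (ψ θ a'))) =
      fun θ => ψ θ a - Real.log (∑ a', Real.exp (ψ θ a')) := by
    funext θ
    rw [Real.log_div (Real.exp_pos _).ne' (hpos θ).ne', Real.log_exp]
  have hψ : ∀ a' θ, HasFDerivAt (fun θ' => ψ θ' a') (fderiv ℝ (fun θ' => ψ θ' a') θ) θ :=
    fun a' θ => (hdiff a' θ).hasFDerivAt
  have hbound : ∀ a' θ, ‖fderiv ℝ (fun θ' => ψ θ' a') θ‖ ≤ lψ := fun a' θ =>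
    norm_gradient_eq_norm_fderiv (fun θ' => ψ θ' a') θ ▸ hgrad a' θ
  have hscore := fun θ => (hψ a θ).fun_sub (hasFDerivAt_log_sum_exp fun a' => hψ a' θ)
  rw [hlog]
  refine ⟨fun θ => (hscore θ).differentiableAt, fun θ => ?_⟩
  rw [norm_gradient_eq_norm_fderiv, (hscore θ).fderiv, two_mul]
  exact norm_sub_le_of_le (hbound a θ)
    (norm_inv_sum_smul_sum_le (fun a' => (Real.exp_pos _).le) (hpos θ) fun a' => hbound a' θ)
end

section
/- Let A be a finite nonempty type, let ℓ_ψ, L_ψ > 0, and let ψ : ℝ^p × A → ℝ be such that for each a ∈ A the map θ ↦ ψ(θ, a) is twice continuously differentiable with ‖∇_θ ψ(θ, a)‖ ≤ ℓ_ψ and ‖∇²_θ ψ(θ, a)‖ ≤ L_ψ (operator norm of the Hessian) for all θ ∈ ℝ^p. Define the softmax policy π_θ(a) := exp(ψ(θ, a)) / Σ_{a' ∈ A} exp(ψ(θ, a')). Then for every a ∈ A and θ ∈ ℝ^p, the Hessian of the log-policy satisfies ‖∇²_θ log π_θ(a)‖ ≤ 2 (L_ψ + ℓ_ψ²). -/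
/-- The softmax weight of `a` for the scores `ψ θ`. -/
noncomputable def softmaxWeight {F A : Type*} [Fintype A] (ψ : F → A → ℝ) (θ : F) (a : A) : ℝ :=
  Real.exp (ψ θ a) / ∑ a', Real.exp (ψ θ a')

section Softmax

variable {F A : Type*} [Fintype A]

theorem sum_exp_pos [Nonempty A] (x : A → ℝ) : 0 < ∑ a, Real.exp (x a) :=
  Finset.sum_pos (fun a _ => Real.exp_pos (x a)) Finset.univ_nonempty

theorem softmaxWeight_pos [Nonempty A] (ψ : F → A → ℝ) (θ : F) (a : A) :
    0 < softmaxWeight ψ θ a :=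
  div_pos (Real.exp_pos _) (sum_exp_pos (ψ θ))

theorem sum_softmaxWeight [Nonempty A] (ψ : F → A → ℝ) (θ : F) :
    ∑ a, softmaxWeight ψ θ a = 1 := by
  simp only [softmaxWeight, ← Finset.sum_div]
  exact div_self (sum_exp_pos (ψ θ)).ne'

theorem norm_sum_softmaxWeight_smul_le [Nonempty A] {E : Type*} [NormedAddCommGroup E]
    [NormedSpace ℝ E] (ψ : F → A → ℝ) (θ : F) {v : A → E} {C : ℝ} (hv : ∀ a, ‖v a‖ ≤ C) :
    ‖∑ a, softmaxWeight ψ θ a • v a‖ ≤ C := by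
  calc ‖∑ a, softmaxWeight ψ θ a • v a‖ ≤ ∑ a, softmaxWeight ψ θ a * C := by
        refine norm_sum_le_of_le _ fun a _ => ?_
        rw [norm_smul, Real.norm_of_nonneg (softmaxWeight_pos ψ θ a).le]
        exact mul_le_mul_of_nonneg_left (hv a) (softmaxWeight_pos ψ θ a).le
    _ = C := by rw [← Finset.sum_mul, sum_softmaxWeight, one_mul]

variable [NormedAddCommGroup F] [InnerProductSpace ℝ F] [CompleteSpace F]

theorem hasGradientAt_log_softmaxWeight [Nonempty A] {ψ : F → A → ℝ} {θ : F} {g : A → F}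
    (hψ : ∀ a, HasGradientAt (fun θ' => ψ θ' a) (g a) θ) (a : A) :
    HasGradientAt (fun θ' => Real.log (softmaxWeight ψ θ' a))
      (g a - ∑ b, softmaxWeight ψ θ b • g b) θ := by
  have hS : HasFDerivAt (fun θ' => ∑ b, Real.exp (ψ θ' b))
      (∑ b, Real.exp (ψ θ b) • InnerProductSpace.toDual ℝ F (g b)) θ :=
    HasFDerivAt.fun_sum fun b _ => (hψ b).hasFDerivAt.exp
  have hlog := (hψ a).hasFDerivAt.sub (hS.log (sum_exp_pos (ψ θ)).ne')
  have heq : (fun θ' => Real.log (softmaxWeight ψ θ' a)) =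
      fun θ' => ψ θ' a - Real.log (∑ b, Real.exp (ψ θ' b)) := by
    funext θ'
    rw [softmaxWeight, Real.log_div (Real.exp_ne_zero _) (sum_exp_pos (ψ θ')).ne', Real.log_exp]
  rw [heq, hasGradientAt_iff_hasFDerivAt]
  refine hlog.congr_fderiv ?_
  simp [softmaxWeight, map_sum, Finset.smul_sum, smul_smul, div_eq_inv_mul]

theorem hasFDerivAt_softmaxWeight [Nonempty A] {ψ : F → A → ℝ} {θ : F} {g : A → F}
    (hψ : ∀ a, HasGradientAt (fun θ' => ψ θ' a) (g a) θ) (a : A) :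
    HasFDerivAt (fun θ' => softmaxWeight ψ θ' a) (softmaxWeight ψ θ a •
      InnerProductSpace.toDual ℝ F (g a - ∑ b, softmaxWeight ψ θ b • g b)) θ := by
  simpa only [Real.exp_log (softmaxWeight_pos ψ _ a)] using
    (hasGradientAt_log_softmaxWeight hψ a).hasFDerivAt.exp

theorem ContDiff.differentiable_gradient {f : F → ℝ} (hf : ContDiff ℝ 2 f) :
    Differentiable ℝ (gradient f) :=
  (InnerProductSpace.toDual ℝ F).symm.differentiable.comp
    ((hf.fderiv_right (m := 1) (by norm_num)).differentiable (by norm_num))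

theorem norm_fderiv_gradient_log_softmaxWeight_le [Nonempty A] {ψ : F → A → ℝ} {l L : ℝ}
    (hsmooth : ∀ a, ContDiff ℝ 2 (fun θ => ψ θ a))
    (hgrad : ∀ a θ, ‖gradient (fun θ' => ψ θ' a) θ‖ ≤ l)
    (hhess : ∀ a θ, ‖fderiv ℝ (gradient (fun θ' => ψ θ' a)) θ‖ ≤ L) (a : A) (θ : F) :
    ‖fderiv ℝ (gradient (fun θ' => Real.log (softmaxWeight ψ θ' a))) θ‖ ≤ 2 * (L + l ^ 2) := by
  set g : A → F → F := fun b => gradient (fun θ' => ψ θ' b) with hg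
  have hψ : ∀ θ b, HasGradientAt (fun θ' => ψ θ' b) (g b θ) θ := fun θ b =>
    ((hsmooth b).differentiable (by norm_num) θ).hasGradientAt
  have hg' : ∀ b, HasFDerivAt (g b) (fderiv ℝ (g b) θ) θ := fun b =>
    ((hsmooth b).differentiable_gradient θ).hasFDerivAt
  have hgradient : gradient (fun θ' => Real.log (softmaxWeight ψ θ' a)) =
      fun θ => g a θ - ∑ b, softmaxWeight ψ θ b • g b θ :=
    funext fun θ => (hasGradientAt_log_softmaxWeight (hψ θ) a).gradient
  set m : F := ∑ b, softmaxWeight ψ θ b • g b θ with hm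
  have hderiv := (hg' a).fun_sub (HasFDerivAt.fun_sum (u := Finset.univ) fun b _ =>
    (hasFDerivAt_softmaxWeight (hψ θ) b).fun_smul (hg' b))
  rw [hgradient, hderiv.fderiv, ← hm, Finset.sum_add_distrib]
  have hl : 0 ≤ l := (norm_nonneg _).trans (hgrad a θ)
  have hm_le : ‖m‖ ≤ l := norm_sum_softmaxWeight_smul_le ψ θ fun b => hgrad b θ
  have hmean : ‖∑ b, softmaxWeight ψ θ b • fderiv ℝ (g b) θ‖ ≤ L :=
    norm_sum_softmaxWeight_smul_le ψ θ fun b => hhess b θ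
  have hcov : ‖∑ b, (softmaxWeight ψ θ b •
      InnerProductSpace.toDual ℝ F (g b θ - m)).smulRight (g b θ)‖ ≤ (l + l) * l := by
    have hsmul : ∀ b, (softmaxWeight ψ θ b •
        InnerProductSpace.toDual ℝ F (g b θ - m)).smulRight (g b θ) = softmaxWeight ψ θ b •
        (InnerProductSpace.toDual ℝ F (g b θ - m)).smulRight (g b θ) := fun b => by
      ext x
      simp [smul_smul]
    simp only [hsmul]
    refine norm_sum_softmaxWeight_smul_le ψ θ fun b => ?_
    rw [ContinuousLinearMap.norm_smulRight_apply, LinearIsometryEquiv.norm_map]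
    exact mul_le_mul ((norm_sub_le _ _).trans (add_le_add (hgrad b θ) hm_le)) (hgrad b θ)
      (norm_nonneg _) (add_nonneg hl hl)
  calc _ ≤ L + (L + (l + l) * l) := (norm_sub_le _ _).trans
        (add_le_add (hhess a θ) ((norm_add_le _ _).trans (add_le_add hmean hcov)))
    _ = 2 * (L + l ^ 2) := by ring

end Softmax


/-- Hessian bound of the softmax score function: if each `θ ↦ ψ θ a` is twice
continuously differentiable with `‖∇ψ‖ ≤ ℓψ` and Hessian operator norm at most `Lψ`,
then for every action `a` the Hessian of the log-softmax `θ ↦ log π_θ(a)` has operator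
norm at most `2 (Lψ + ℓψ²)`. -/
theorem stmt_17 {p : ℕ} {A : Type*} [Fintype A] [Nonempty A]
    (ψ : EuclideanSpace ℝ (Fin p) → A → ℝ) (lψ Lψ : ℝ) (hlψ : 0 < lψ) (hLψ : 0 < Lψ)
    (hsmooth : ∀ a, ContDiff ℝ 2 (fun θ => ψ θ a))
    (hgrad : ∀ a θ, ‖gradient (fun θ' => ψ θ' a) θ‖ ≤ lψ)
    (hhess : ∀ a θ, ‖fderiv ℝ (gradient (fun θ' => ψ θ' a)) θ‖ ≤ Lψ) :
    ∀ (a : A) (θ : EuclideanSpace ℝ (Fin p)),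
      ‖fderiv ℝ
        (gradient (fun θ' => Real.log (Real.exp (ψ θ' a) / ∑ a', Real.exp (ψ θ' a')))) θ‖
          ≤ 2 * (Lψ + lψ ^ 2) := by
  exact norm_fderiv_gradient_log_softmaxWeight_le hsmooth hgrad hhess
end
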